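/- Fix 0 < ε < 0.5. Then: (1) for all integers n ≥ 1 and 1 ≤ k ≤ n/2, γ(n,k,2k) ≥ C(n,k)/C(2k,k); and (2) for every η > 0 there exists N such that for all n ≥ N and all positive integers k with k ≤ log₄ log₄ (n^{0.5−ε}), γ(n,k,2k) ≤ (1+η) · C(n,k)/C(2k,k), where C(a,b) denotes the binomial coefficient. -/

import Mathlib

/-- `gammaE n k r` is the minimum cardinality of a family of `r`-element subsets of `[n]`
such that every `k`-bicoloring `B` of `[n]` (identified with its `+1`-class `P`, `|P| = k`)
has an unbiased representative in the family, i.e. some member `A` with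
`|A ∩ B(+1)| = |A ∩ B(-1)|`. -/
noncomputable def gammaE (n k r : ℕ) : ℕ :=
  sInf {m | ∃ 𝒜 : Finset (Finset (Fin n)),
    𝒜.card = m ∧
    (∀ A ∈ 𝒜, A.card = r) ∧
    (∀ P : Finset (Fin n), P.card = k →
      ∃ A ∈ 𝒜, (A ∩ P).card = (A ∩ Pᶜ).card)}

section CoverDesigns

open Finset

section BernoulliMean

variable {ι : Type*} [DecidableEq ι]

/-- The expectation of `f S`, where `S` is a random subset of `E` that contains each element
independently with probability `p`. -/
noncomputable def bernoulliMean (p : ℝ) (E : Finset ι) (f : Finset ι → ℝ) : ℝ :=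
  ∑ S ∈ E.powerset, p ^ #S * (1 - p) ^ #(E \ S) * f S

variable {p : ℝ} {E : Finset ι} {f g : Finset ι → ℝ}

lemma bernoulliMean_empty : bernoulliMean p ∅ f = f ∅ := by
  simp [bernoulliMean]

lemma bernoulliMean_insert {a : ι} (ha : a ∉ E) :
    bernoulliMean p (insert a E) f =
      bernoulliMean p E fun S => (1 - p) * f S + p * f (insert a S) := by
  unfold bernoulliMean
  rw [sum_powerset_insert ha, ← sum_add_distrib]
  refine sum_congr rfl fun S hS => ?_
  have hS : S ⊆ E := mem_powerset.1 hS
  have haS : a ∉ S := fun h => ha (hS h)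
  rw [insert_sdiff_of_notMem _ haS, card_insert_of_notMem (fun h => ha (mem_sdiff.1 h).1),
    insert_sdiff_insert, sdiff_insert_of_notMem ha, card_insert_of_notMem haS]
  ring

lemma bernoulliMean_mono (hp : 0 ≤ p) (hp' : p ≤ 1) (h : ∀ S ⊆ E, f S ≤ g S) :
    bernoulliMean p E f ≤ bernoulliMean p E g := by
  refine sum_le_sum fun S hS => mul_le_mul_of_nonneg_left (h S (mem_powerset.1 hS)) ?_
  have : 0 ≤ 1 - p := by linarith
  positivity

lemma bernoulliMean_congr (h : ∀ S ⊆ E, f S = g S) :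
    bernoulliMean p E f = bernoulliMean p E g :=
  sum_congr rfl fun S hS => by rw [h S (mem_powerset.1 hS)]

lemma bernoulliMean_add :
    bernoulliMean p E (fun S => f S + g S) = bernoulliMean p E f + bernoulliMean p E g := by
  simp [bernoulliMean, mul_add, sum_add_distrib]

lemma bernoulliMean_const_mul (c : ℝ) :
    bernoulliMean p E (fun S => c * f S) = c * bernoulliMean p E f := by
  unfold bernoulliMean
  rw [mul_sum]
  exact sum_congr rfl fun S _ => by ring

lemma bernoulliMean_sum {κ : Type*} (s : Finset κ) (h : κ → Finset ι → ℝ) :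
    bernoulliMean p E (fun S => ∑ k ∈ s, h k S) = ∑ k ∈ s, bernoulliMean p E (h k) := by
  unfold bernoulliMean
  rw [sum_comm]
  exact sum_congr rfl fun S _ => by rw [mul_sum]

lemma bernoulliMean_const (c : ℝ) : bernoulliMean p E (fun _ => c) = c := by
  induction E using Finset.induction_on with
  | empty => exact bernoulliMean_empty
  | insert a E ha ih =>
    rw [bernoulliMean_insert ha]
    convert ih using 2
    ext S
    ring

lemma bernoulliMean_disjoint (F : Finset ι) :
    bernoulliMean p E (fun S => if Disjoint S F then 1 else 0) = (1 - p) ^ #(E ∩ F) := by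
  induction E using Finset.induction_on with
  | empty => simp [bernoulliMean_empty]
  | insert a E ha ih =>
    rw [bernoulliMean_insert ha]
    by_cases haF : a ∈ F
    · rw [insert_inter_of_mem haF, card_insert_of_notMem (fun h => ha (mem_inter.1 h).1),
        pow_succ', ← ih, ← bernoulliMean_const_mul]
      exact bernoulliMean_congr fun S _ => by simp [haF]
    · rw [insert_inter_of_notMem haF, ← ih]
      exact bernoulliMean_congr fun S _ => by
        simp only [disjoint_insert_left, haF, not_false_eq_true, true_and]
        ring

lemma bernoulliMean_card : bernoulliMean p E (fun S => (#S : ℝ)) = p * #E := by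
  induction E using Finset.induction_on with
  | empty => simp [bernoulliMean_empty]
  | insert a E ha ih =>
    rw [bernoulliMean_insert ha, card_insert_of_notMem ha]
    have : bernoulliMean p E (fun S => (1 - p) * (#S : ℝ) + p * (#(insert a S) : ℝ)) =
        bernoulliMean p E (fun S => (#S : ℝ) + p) :=
      bernoulliMean_congr fun S hS => by
        rw [card_insert_of_notMem fun h => ha (hS h)]
        push_cast
        ring
    rw [this, bernoulliMean_add, ih, bernoulliMean_const]
    push_cast
    ring

lemma exists_le_bernoulliMean (hp : 0 ≤ p) (hp' : p ≤ 1) (f : Finset ι → ℝ) :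
    ∃ S ⊆ E, f S ≤ bernoulliMean p E f := by
  induction E using Finset.induction_on generalizing f with
  | empty => exact ⟨∅, subset_rfl, bernoulliMean_empty.ge⟩
  | insert a E ha ih =>
    obtain ⟨S, hS, h⟩ := ih fun S => (1 - p) * f S + p * f (insert a S)
    rw [← bernoulliMean_insert ha] at h
    by_cases h' : f S ≤ bernoulliMean p (insert a E) f
    · exact ⟨S, hS.trans (subset_insert _ _), h'⟩
    · refine ⟨insert a S, insert_subset_insert _ hS, ?_⟩
      by_contra h''
      push Not at h' h''
      rcases hp.eq_or_lt with rfl | hp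
      · linarith
      · nlinarith

lemma bernoulli_exp_le {x y : ℝ} (hp : 0 ≤ p) (h : |y - x| ≤ 1) :
    (1 - p) * Real.exp x + p * Real.exp y ≤
      Real.exp ((1 - p) * x + p * y + p * (y - x) ^ 2) := by
  have h1 : Real.exp (y - x) ≤ 1 + (y - x) + (y - x) ^ 2 := by
    have := (abs_le.1 (Real.abs_exp_sub_one_sub_id_le h)).2
    linarith
  have h2 := Real.add_one_le_exp (p * (y - x) + p * (y - x) ^ 2)
  have e1 : Real.exp y = Real.exp x * Real.exp (y - x) := by rw [← Real.exp_add]; ring_nf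
  have e2 : Real.exp ((1 - p) * x + p * y + p * (y - x) ^ 2) =
      Real.exp x * Real.exp (p * (y - x) + p * (y - x) ^ 2) := by rw [← Real.exp_add]; ring_nf
  rw [e1, e2]
  have hx := Real.exp_pos x
  have h3 : 1 - p + p * Real.exp (y - x) ≤ Real.exp (p * (y - x) + p * (y - x) ^ 2) := by
    nlinarith
  nlinarith

lemma bernoulliMean_exp_le {c : ι → ℝ} {l : ℝ} (hp : 0 ≤ p) (hp' : p ≤ 1)
    (hc : ∀ a ∈ E, |l| * c a ≤ 1) (hf : ∀ a ∈ E, ∀ S, |f (insert a S) - f S| ≤ c a) :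
    bernoulliMean p E (fun S => Real.exp (l * f S)) ≤
      Real.exp (l * bernoulliMean p E f + l ^ 2 * p * ∑ a ∈ E, c a ^ 2) := by
  induction E using Finset.induction_on generalizing f with
  | empty => simp [bernoulliMean_empty]
  | insert a E ha ih =>
    rw [bernoulliMean_insert ha, bernoulliMean_insert ha, sum_insert ha]
    set g : Finset ι → ℝ := fun S => (1 - p) * f S + p * f (insert a S) with hg
    have hgc : ∀ b ∈ E, ∀ S, |g (insert b S) - g S| ≤ c b := by
      intro b hb S
      have h1 := abs_le.1 (hf b (mem_insert_of_mem hb) S)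
      have h2 := abs_le.1 (hf b (mem_insert_of_mem hb) (insert a S))
      rw [insert_comm] at h2
      simp only [hg]
      rw [abs_le]
      constructor <;> nlinarith
    have key : ∀ S ⊆ E, (1 - p) * Real.exp (l * f S) + p * Real.exp (l * f (insert a S)) ≤
        Real.exp (l ^ 2 * p * c a ^ 2) * Real.exp (l * g S) := by
      intro S _
      have h1 := hf a (mem_insert_self _ _) S
      have h2 : |l * f (insert a S) - l * f S| ≤ |l| * c a := by
        rw [← mul_sub, abs_mul]
        exact mul_le_mul_of_nonneg_left h1 (abs_nonneg _)
      refine (bernoulli_exp_le hp (h2.trans (hc a (mem_insert_self _ _)))).trans ?_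
      rw [← Real.exp_add]
      apply Real.exp_le_exp.2
      have h3 : (l * f (insert a S) - l * f S) ^ 2 ≤ l ^ 2 * c a ^ 2 := by
        rw [← mul_pow, ← sq_abs, ← sq_abs (l * c a), abs_mul l (c a)]
        refine pow_le_pow_left₀ (abs_nonneg _) (h2.trans ?_) 2
        exact mul_le_mul_of_nonneg_left (le_abs_self _) (abs_nonneg _)
      simp only [hg]
      nlinarith [mul_le_mul_of_nonneg_left h3 hp]
    refine (bernoulliMean_mono hp hp' key).trans ?_
    rw [bernoulliMean_const_mul]
    refine (mul_le_mul_of_nonneg_left (ih (fun b hb => hc b (mem_insert_of_mem hb)) hgc)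
      (Real.exp_pos _).le).trans ?_
    rw [← Real.exp_add]
    exact le_of_eq (by ring_nf)

end BernoulliMean

lemma one_sub_pow_le_exp {p : ℝ} (hp' : p ≤ 1) (m : ℕ) : (1 - p) ^ m ≤ Real.exp (-(p * m)) := by
  have h := pow_le_pow_left₀ (sub_nonneg.2 hp') (Real.one_sub_le_exp_neg p) m
  rwa [← Real.exp_nat_mul, mul_neg, mul_comm (m : ℝ)] at h

lemma exp_le_one_sub_pow {p : ℝ} (hp : 0 ≤ p) (hp' : p ≤ 1 / 2) (m : ℕ) :
    Real.exp (-((p + p ^ 2) * m)) ≤ (1 - p) ^ m := by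
  have h1 : Real.exp (-(p + p ^ 2)) ≤ 1 - p := by
    have h2 := Real.quadratic_le_exp_of_nonneg (show 0 ≤ p + p ^ 2 by positivity)
    rw [Real.exp_neg, inv_le_comm₀ (Real.exp_pos _) (by linarith)]
    refine le_trans ?_ h2
    rw [inv_le_iff_one_le_mul₀ (by linarith)]
    nlinarith [pow_nonneg hp 2, pow_nonneg hp 3, mul_nonneg (pow_nonneg hp 2) (sub_nonneg.2 hp'),
      mul_nonneg (pow_nonneg hp 3) (sub_nonneg.2 hp'),
      mul_nonneg (pow_nonneg hp 4) (sub_nonneg.2 hp')]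
  have h := pow_le_pow_left₀ (Real.exp_pos _).le h1 m
  rwa [← Real.exp_nat_mul, mul_neg, mul_comm (m : ℝ)] at h

lemma sum_card_sub_le_card_biUnion {α β : Type*} [DecidableEq α] [DecidableEq β] (t : Finset α)
    (A : α → Finset β) (C : ℝ) (hC : 0 ≤ C)
    (h : ∀ x ∈ t, ∀ y ∈ t, x ≠ y → (#(A x ∩ A y) : ℝ) ≤ C) :
    ∑ x ∈ t, (#(A x) : ℝ) - (#t : ℝ) ^ 2 * C ≤ #(t.biUnion A) := by
  induction t using Finset.induction_on with
  | empty => simp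
  | insert a t ha ih =>
    have ih := ih fun x hx y hy => h x (mem_insert_of_mem hx) y (mem_insert_of_mem hy)
    rw [sum_insert ha, biUnion_insert, card_insert_of_notMem ha]
    have h1 : (#(A a ∩ t.biUnion A) : ℝ) ≤ #t * C := by
      rw [inter_biUnion]
      calc (#(t.biUnion fun x => A a ∩ A x) : ℝ) ≤ ∑ x ∈ t, (#(A a ∩ A x) : ℝ) := by
            exact_mod_cast card_biUnion_le
        _ ≤ ∑ _x ∈ t, C := sum_le_sum fun x hx => h a (mem_insert_self _ _) x
            (mem_insert_of_mem hx) (by rintro rfl; exact ha hx)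
        _ = _ := by simp
    have h2 : (#(A a ∪ t.biUnion A) : ℝ) + #(A a ∩ t.biUnion A) = #(A a) + #(t.biUnion A) := by
      exact_mod_cast card_union_add_card_inter _ _
    push_cast
    nlinarith

section Nibble

variable {ι V : Type*} [DecidableEq V]

/-- The hyperedges through the vertex `v`. -/
def edgesAt (e : ι → Finset V) (E : Finset ι) (v : V) : Finset ι := {i ∈ E | v ∈ e i}

/-- The hyperedges `j` that avoid `v` but meet the hyperedge `i`. -/
def blockers (e : ι → Finset V) (E : Finset ι) (v : V) (i : ι) : Finset ι :=
  {j ∈ E | v ∉ e j ∧ ¬Disjoint (e j) (e i)}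

variable {e : ι → Finset V} {E : Finset ι}

lemma mem_edgesAt {v : V} {i : ι} : i ∈ edgesAt e E v ↔ i ∈ E ∧ v ∈ e i := mem_filter

lemma blockers_subset (v : V) (i : ι) : blockers e E v i ⊆ E := filter_subset _ _

variable [DecidableEq ι]

/-- The number of hyperedges through `v` that are not blocked by any member of `S`. -/
noncomputable def unblocked (e : ι → Finset V) (E : Finset ι) (v : V) (S : Finset ι) : ℝ :=
  ∑ i ∈ edgesAt e E v, if Disjoint S (blockers e E v i) then 1 else 0

/-- `E` is an `r`-uniform hypergraph on the vertex set `W`, all of whose degrees are within a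
factor `exp θ` of `d`, and all of whose codegrees are at most `C`. -/
structure NearRegular (e : ι → Finset V) (W : Finset V) (E : Finset ι) (r : ℕ) (d θ C : ℝ) :
    Prop where
  subset : ∀ i ∈ E, e i ⊆ W
  card_eq : ∀ i ∈ E, #(e i) = r
  le_deg : ∀ v ∈ W, d * Real.exp (-θ) ≤ #(edgesAt e E v)
  deg_le : ∀ v ∈ W, (#(edgesAt e E v) : ℝ) ≤ d * Real.exp θ
  codeg_le : ∀ u v, u ≠ v → (#(edgesAt e E u ∩ edgesAt e E v) : ℝ) ≤ C

variable {W : Finset V} {r : ℕ} {d θ C : ℝ}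

lemma blockers_eq_biUnion (v : V) (i : ι) :
    blockers e E v i = ((e i).erase v).biUnion fun x => edgesAt e E x \ edgesAt e E v := by
  ext j
  simp only [blockers, mem_filter, mem_biUnion, mem_erase, mem_sdiff, mem_edgesAt, not_disjoint_iff]
  constructor
  · rintro ⟨hj, hv, x, hxj, hxi⟩
    exact ⟨x, ⟨by rintro rfl; exact hv hxj, hxi⟩, ⟨hj, hxj⟩, fun h => hv h.2⟩
  · rintro ⟨x, ⟨-, hxi⟩, ⟨hj, hxj⟩, h⟩
    exact ⟨hj, fun hv => h ⟨hj, hv⟩, x, hxj, hxi⟩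

lemma NearRegular.card_erase (H : NearRegular e W E r d θ C) {v : V} {i : ι}
    (hi : i ∈ edgesAt e E v) : (#((e i).erase v) : ℝ) = r - 1 := by
  rw [mem_edgesAt] at hi
  have h := card_erase_add_one hi.2
  rw [H.card_eq i hi.1] at h
  rw [← h]
  push_cast
  ring

lemma NearRegular.card_blockers_le (H : NearRegular e W E r d θ C) {v : V} {i : ι}
    (hi : i ∈ edgesAt e E v) : (#(blockers e E v i) : ℝ) ≤ (r - 1) * (d * Real.exp θ) := by
  rw [blockers_eq_biUnion, ← H.card_erase hi, ← nsmul_eq_mul, ← sum_const]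
  refine le_trans (b := ∑ x ∈ (e i).erase v, (#(edgesAt e E x \ edgesAt e E v) : ℝ))
    (by exact_mod_cast card_biUnion_le) (sum_le_sum fun x hx => ?_)
  refine le_trans ?_ (H.deg_le x (H.subset i (mem_edgesAt.1 hi).1 (mem_of_mem_erase hx)))
  exact_mod_cast card_le_card sdiff_subset

lemma NearRegular.le_card_blockers (H : NearRegular e W E r d θ C) (hC : 0 ≤ C) (hr : 1 ≤ r)
    {v : V} {i : ι} (hi : i ∈ edgesAt e E v) :
    (r - 1) * (d * Real.exp (-θ)) - 2 * r ^ 2 * C ≤ #(blockers e E v i) := by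
  have h1 := sum_card_sub_le_card_biUnion ((e i).erase v)
    (fun x => edgesAt e E x \ edgesAt e E v) C hC
    fun x _ y _ hxy => le_trans (by
      exact_mod_cast card_le_card (inter_subset_inter sdiff_subset sdiff_subset))
      (H.codeg_le x y hxy)
  rw [← blockers_eq_biUnion, H.card_erase hi] at h1
  have h2 : ∑ _x ∈ (e i).erase v, (d * Real.exp (-θ) - C) ≤
      ∑ x ∈ (e i).erase v, (#(edgesAt e E x \ edgesAt e E v) : ℝ) := by
    refine sum_le_sum fun x hx => ?_
    have h3 := H.le_deg x (H.subset i (mem_edgesAt.1 hi).1 (mem_of_mem_erase hx))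
    have h4 := H.codeg_le x v (ne_of_mem_erase hx)
    have h5 : (#(edgesAt e E x \ edgesAt e E v) : ℝ) + #(edgesAt e E x ∩ edgesAt e E v) =
        #(edgesAt e E x) := by
      exact_mod_cast card_sdiff_add_card_inter _ _
    linarith
  rw [sum_const, nsmul_eq_mul, H.card_erase hi] at h2
  have hr' : (1 : ℝ) ≤ r := by exact_mod_cast hr
  nlinarith [mul_nonneg (sub_nonneg.2 hr') hC,
    mul_nonneg (mul_nonneg (sub_nonneg.2 hr') hC) (sub_nonneg.2 hr')]

lemma bernoulliMean_unblocked (p : ℝ) (v : V) :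
    bernoulliMean p E (unblocked e E v) =
      ∑ i ∈ edgesAt e E v, (1 - p) ^ #(blockers e E v i) := by
  unfold unblocked
  rw [bernoulliMean_sum]
  refine sum_congr rfl fun i _ => ?_
  rw [bernoulliMean_disjoint, inter_eq_right.2 (blockers_subset v _)]

variable {ε τ : ℝ}

lemma exp_le_one_add_two_mul {x : ℝ} (h0 : 0 ≤ x) (h1 : x ≤ 1) : Real.exp x ≤ 1 + 2 * x := by
  have := (abs_le.1 (Real.abs_exp_sub_one_sub_id_le (x := x) (by rwa [abs_of_nonneg h0]))).2
  nlinarith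

lemma NearRegular.le_mean (H : NearRegular e W E r d θ C) (hr : 1 ≤ r) (hε : 0 < ε)
    (hεr : ε * r ≤ 1 / 8) (hd : 0 < d) (hθ : 0 ≤ θ) (hθ1 : θ ≤ 1) (hp : ε / d ≤ 1 / 2)
    (hpτ : ε / d ≤ τ) {v : V} (hv : v ∈ W) :
    d * Real.exp (-(ε * (r - 1))) * Real.exp (-(5 / 4 * θ + τ)) ≤
      bernoulliMean (ε / d) E (unblocked e E v) := by
  set p := ε / d with hpd
  have hpp : 0 < p := by positivity
  have hr' : (1 : ℝ) ≤ r := by exact_mod_cast hr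
  rw [bernoulliMean_unblocked]
  have h1 : ∀ i ∈ edgesAt e E v,
      Real.exp (-((p + p ^ 2) * ((r - 1) * (d * Real.exp θ)))) ≤ (1 - p) ^ #(blockers e E v i) := by
    intro i hi
    refine le_trans (Real.exp_le_exp.2 ?_) (exp_le_one_sub_pow hpp.le hp _)
    have := H.card_blockers_le hi
    gcongr
  refine le_trans ?_ (sum_le_sum h1)
  rw [sum_const, nsmul_eq_mul]
  refine le_trans ?_ (mul_le_mul_of_nonneg_right (H.le_deg v hv) (Real.exp_pos _).le)
  rw [mul_assoc, mul_assoc, ← Real.exp_add, ← Real.exp_add]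
  refine mul_le_mul_of_nonneg_left (Real.exp_le_exp.2 ?_) hd.le
  have e1 : (p + p ^ 2) * ((r - 1) * (d * Real.exp θ)) = ε * (r - 1) * ((1 + p) * Real.exp θ) := by
    have : p * d = ε := by rw [hpd]; field_simp
    rw [← this]; ring
  rw [e1]
  have h2 : (1 + p) * Real.exp θ ≤ 1 + (2 * θ + 3 * p) := by
    have := exp_le_one_add_two_mul hθ hθ1
    nlinarith
  have h3 : ε * (r - 1) * ((1 + p) * Real.exp θ) ≤ ε * (r - 1) * (1 + (2 * θ + 3 * p)) :=
    mul_le_mul_of_nonneg_left h2 (mul_nonneg hε.le (by linarith))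
  have h4 : ε * (r - 1) * (2 * θ + 3 * p) ≤ 1 / 8 * (2 * θ + 3 * p) :=
    mul_le_mul_of_nonneg_right (by nlinarith) (by positivity)
  nlinarith

lemma NearRegular.mean_le (H : NearRegular e W E r d θ C) (hr : 1 ≤ r) (hε : 0 < ε)
    (hεr : ε * r ≤ 1 / 8) (hd : 0 < d) (hθ : 0 ≤ θ) (hp : ε / d ≤ 1 / 2) (hC : 0 ≤ C)
    (hCτ : r * C ≤ τ * d) {v : V} (hv : v ∈ W) :
    bernoulliMean (ε / d) E (unblocked e E v) ≤
      d * Real.exp (-(ε * (r - 1))) * Real.exp (5 / 4 * θ + τ) := by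
  set p := ε / d with hpd
  have hpp : 0 < p := by positivity
  have hr' : (1 : ℝ) ≤ r := by exact_mod_cast hr
  rw [bernoulliMean_unblocked]
  have h1 : ∀ i ∈ edgesAt e E v, (1 - p) ^ #(blockers e E v i) ≤
      Real.exp (-(p * ((r - 1) * (d * Real.exp (-θ)) - 2 * r ^ 2 * C))) := by
    intro i hi
    refine le_trans (one_sub_pow_le_exp (by linarith) _) (Real.exp_le_exp.2 ?_)
    have := H.le_card_blockers hC hr hi
    gcongr
  refine le_trans (sum_le_sum h1) ?_
  rw [sum_const, nsmul_eq_mul]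
  refine le_trans (mul_le_mul_of_nonneg_right (H.deg_le v hv) (Real.exp_pos _).le) ?_
  rw [mul_assoc d, mul_assoc d, ← Real.exp_add, ← Real.exp_add]
  refine mul_le_mul_of_nonneg_left (Real.exp_le_exp.2 ?_) hd.le
  have hpe : p * d = ε := by rw [hpd]; field_simp
  have e1 : p * ((r - 1) * (d * Real.exp (-θ)) - 2 * r ^ 2 * C) =
      ε * (r - 1) * Real.exp (-θ) - 2 * (p * r) * (r * C) := by
    rw [← hpe]; ring
  have hτ : 0 ≤ τ := by
    by_contra! h
    nlinarith [mul_nonneg (by linarith : (0 : ℝ) ≤ r) hC]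
  have h2 : (p * r) * (r * C) ≤ 1 / 8 * τ := by
    calc (p * r) * (r * C) ≤ (p * r) * (τ * d) :=
          mul_le_mul_of_nonneg_left hCτ (by positivity)
      _ = (ε * r) * τ := by rw [← hpe]; ring
      _ ≤ 1 / 8 * τ := mul_le_mul_of_nonneg_right hεr hτ
  have h3 : ε * (r - 1) * (1 - θ) ≤ ε * (r - 1) * Real.exp (-θ) :=
    mul_le_mul_of_nonneg_left (Real.one_sub_le_exp_neg θ) (mul_nonneg hε.le (by linarith))
  have h4 : ε * (r - 1) * θ ≤ 1 / 8 * θ := mul_le_mul_of_nonneg_right (by nlinarith) hθ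
  rw [e1]
  nlinarith

lemma abs_unblocked_insert_sub_le (v : V) (j : ι) (S : Finset ι) :
    |unblocked e E v (insert j S) - unblocked e E v S| ≤
      #{i ∈ edgesAt e E v | j ∈ blockers e E v i} := by
  unfold unblocked
  rw [← sum_sub_distrib, card_filter]
  push_cast
  refine (abs_sum_le_sum_abs _ _).trans (sum_le_sum fun i _ => ?_)
  by_cases h1 : j ∈ blockers e E v i <;> by_cases h2 : Disjoint S (blockers e E v i) <;>
    simp [disjoint_insert_left, h1, h2]

lemma NearRegular.card_filter_blockers_le (H : NearRegular e W E r d θ C) (hC : 0 ≤ C)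
    (v : V) {j : ι} (hj : j ∈ E) :
    (#{i ∈ edgesAt e E v | j ∈ blockers e E v i} : ℝ) ≤ r * C := by
  by_cases hv : v ∈ e j
  · have : ({i ∈ edgesAt e E v | j ∈ blockers e E v i} : Finset ι) = ∅ := by
      simp [blockers, hv]
    rw [this]
    simpa using mul_nonneg (Nat.cast_nonneg r) hC
  · have h1 : ({i ∈ edgesAt e E v | j ∈ blockers e E v i} : Finset ι) ⊆
        (e j).biUnion fun u => edgesAt e E u ∩ edgesAt e E v := by
      intro i hi
      simp only [blockers, mem_filter, not_disjoint_iff] at hi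
      obtain ⟨hi, -, -, x, hxj, hxi⟩ := hi
      exact mem_biUnion.2 ⟨x, hxj, mem_inter.2 ⟨mem_edgesAt.2 ⟨(mem_edgesAt.1 hi).1, hxi⟩, hi⟩⟩
    calc (#{i ∈ edgesAt e E v | j ∈ blockers e E v i} : ℝ)
        ≤ ∑ u ∈ e j, (#(edgesAt e E u ∩ edgesAt e E v) : ℝ) := by
          exact_mod_cast (card_le_card h1).trans card_biUnion_le
      _ ≤ ∑ _u ∈ e j, C := sum_le_sum fun u hu =>
          H.codeg_le u v (by rintro rfl; exact hv hu)
      _ = r * C := by rw [sum_const, nsmul_eq_mul, H.card_eq j hj]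

lemma exp_le_three {x : ℝ} (h : x ≤ 1) : Real.exp x ≤ 3 :=
  (Real.exp_le_exp.2 h).trans Real.exp_one_lt_three.le

lemma NearRegular.sum_sq_le (H : NearRegular e W E r d θ C) (hC : 0 ≤ C) (hd : 0 < d)
    (hθ1 : θ ≤ 1) (hr : 1 ≤ r) {v : V} (hv : v ∈ W) :
    ∑ j ∈ E, (#{i ∈ edgesAt e E v | j ∈ blockers e E v i} : ℝ) ^ 2 ≤
      9 * r ^ 2 * C * d ^ 2 := by
  have hr' : (1 : ℝ) ≤ r := by exact_mod_cast hr
  have h3 := exp_le_three hθ1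
  have h0 : ∑ j ∈ E, (#{i ∈ edgesAt e E v | j ∈ blockers e E v i} : ℝ) =
      ∑ i ∈ edgesAt e E v, (#(blockers e E v i) : ℝ) := by
    simp_rw [card_filter]
    push_cast
    rw [sum_comm]
    refine sum_congr rfl fun i _ => ?_
    rw [sum_boole, filter_mem_eq_inter, inter_eq_right.2 (blockers_subset v _)]
  calc ∑ j ∈ E, (#{i ∈ edgesAt e E v | j ∈ blockers e E v i} : ℝ) ^ 2
      ≤ ∑ j ∈ E, r * C * (#{i ∈ edgesAt e E v | j ∈ blockers e E v i} : ℝ) :=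
        sum_le_sum fun j hj => by
          rw [sq]
          exact mul_le_mul_of_nonneg_right (H.card_filter_blockers_le hC v hj)
            (Nat.cast_nonneg _)
    _ = r * C * ∑ i ∈ edgesAt e E v, (#(blockers e E v i) : ℝ) := by rw [← mul_sum, h0]
    _ ≤ r * C * ∑ _i ∈ edgesAt e E v, (r * (d * 3) : ℝ) := by
        refine mul_le_mul_of_nonneg_left (sum_le_sum fun i hi => ?_) (by positivity)
        refine (H.card_blockers_le hi).trans ?_
        gcongr
        linarith
    _ ≤ r * C * ((d * 3) * (r * (d * 3))) := by
        rw [sum_const, nsmul_eq_mul]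
        gcongr
        exact (H.deg_le v hv).trans (by gcongr)
    _ = 9 * r ^ 2 * C * d ^ 2 := by ring

/-- Exponential concentration of `unblocked`, in both directions. -/
lemma NearRegular.mean_exp_le (H : NearRegular e W E r d θ C) (hC : 0 < C) (hd : 0 < d)
    (hθ1 : θ ≤ 1) (hr : 1 ≤ r) (hε : 0 < ε) (hεr : ε * r ≤ 1 / 8) (hp : ε / d ≤ 1 / 2)
    (hτ : 0 < τ) (hτ1 : τ ≤ 1) {D Λ : ℝ} (hD : d / 2 ≤ D)
    (hΛ : 144 * C * r * Λ ≤ d * τ ^ 2) {v : V} (hv : v ∈ W) {σ : ℝ} (hσ : |σ| = 1) :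
    bernoulliMean (ε / d) E (fun S => Real.exp (σ * (τ / (36 * r * C)) *
        (unblocked e E v S - bernoulliMean (ε / d) E (unblocked e E v)))) *
      Real.exp (-(τ / (36 * r * C)) * (τ * D)) ≤ Real.exp (-Λ) := by
  have hr' : (1 : ℝ) ≤ r := by exact_mod_cast hr
  have hp0 : 0 < ε / d := by positivity
  set l := τ / (36 * r * C) with hl
  have hl0 : 0 < l := by positivity
  set μ := bernoulliMean (ε / d) E (unblocked e E v) with hμ
  have e1 : (fun S => Real.exp (σ * l * (unblocked e E v S - μ))) =
      fun S => Real.exp (-(σ * l * μ)) * Real.exp (σ * l * unblocked e E v S) := by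
    ext S
    rw [← Real.exp_add]
    ring_nf
  have hlC : l * (r * C) = τ / 36 := by rw [hl]; field_simp
  have hσl : |σ * l| = l := by rw [abs_mul, hσ, one_mul, abs_of_pos hl0]
  have h1 := bernoulliMean_exp_le (p := ε / d) (E := E) (f := unblocked e E v)
    (c := fun j => (#{i ∈ edgesAt e E v | j ∈ blockers e E v i} : ℝ)) (l := σ * l) hp0.le
    (by linarith) (fun j hj => by
      rw [hσl]
      refine (mul_le_mul_of_nonneg_left (H.card_filter_blockers_le hC.le v hj) hl0.le).trans ?_
      rw [hlC]
      linarith) (fun j _ S => abs_unblocked_insert_sub_le v j S)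
  rw [e1, bernoulliMean_const_mul]
  refine (mul_le_mul_of_nonneg_right (mul_le_mul_of_nonneg_left h1 (Real.exp_pos _).le)
    (Real.exp_pos _).le).trans ?_
  rw [← Real.exp_add, ← Real.exp_add]
  apply Real.exp_le_exp.2
  have hσ2 : (σ * l) ^ 2 = l ^ 2 := by rw [← sq_abs, hσl]
  rw [hσ2]
  have h2 : l ^ 2 * (ε / d) * ∑ j ∈ E, (#{i ∈ edgesAt e E v | j ∈ blockers e E v i} : ℝ) ^ 2 ≤
      l ^ 2 * (ε / d) * (9 * r ^ 2 * C * d ^ 2) :=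
    mul_le_mul_of_nonneg_left (H.sum_sq_le hC.le hd hθ1 hr hv) (by positivity)
  have h3 : l ^ 2 * (ε / d) * (9 * r ^ 2 * C * d ^ 2) ≤ d * τ ^ 2 / (C * r) / 1152 := by
    have : l ^ 2 * (ε / d) * (9 * r ^ 2 * C * d ^ 2) = (ε * r) * (d * τ ^ 2 / (C * r) / 144) := by
      rw [hl]; field_simp; norm_num
    rw [this]
    calc (ε * r) * (d * τ ^ 2 / (C * r) / 144) ≤ 1 / 8 * (d * τ ^ 2 / (C * r) / 144) :=
          mul_le_mul_of_nonneg_right hεr (by positivity)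
      _ = _ := by ring
  have h4 : d * τ ^ 2 / (C * r) / 72 ≤ l * (τ * D) := by
    calc d * τ ^ 2 / (C * r) / 72 = l * (τ * (d / 2)) := by rw [hl]; field_simp; norm_num
      _ ≤ _ := by gcongr
  have h5 : 144 * Λ ≤ d * τ ^ 2 / (C * r) := by
    rw [le_div_iff₀ (by positivity)]
    linarith
  have h6 : 0 ≤ d * τ ^ 2 / (C * r) := by positivity
  linarith

end Nibble

section Bite

variable {ι V : Type*} [DecidableEq V]
variable {e : ι → Finset V} {W : Finset V} {E : Finset ι} {r : ℕ} {d θ C ε τ : ℝ}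

lemma disjoint_edgesAt_iff {S : Finset ι} (hS : S ⊆ E) (v : V) :
    Disjoint S (edgesAt e E v) ↔ v ∉ S.biUnion e := by
  simp only [disjoint_left, mem_edgesAt, mem_biUnion, not_exists, not_and]
  exact forall₂_congr fun i hi => by simp [hS hi]

variable [DecidableEq ι]

lemma unblocked_eq_card {S : Finset ι} (hS : S ⊆ E) {v : V} (hv : v ∉ S.biUnion e) :
    unblocked e E v S = #(edgesAt e {i ∈ E | Disjoint (e i) (S.biUnion e)} v) := by
  rw [unblocked, sum_boole]
  congr 2
  ext i
  simp only [mem_filter, mem_edgesAt, blockers, disjoint_left, mem_biUnion, not_exists, not_and]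
  simp only [mem_biUnion, not_exists, not_and] at hv
  constructor
  · rintro ⟨⟨hi, hvi⟩, h⟩
    exact ⟨⟨hi, fun x hx j hj hxj => h hj (hS hj) (hv j hj) fun h' => h' hxj hx⟩, hvi⟩
  · rintro ⟨⟨hi, h⟩, hvi⟩
    exact ⟨⟨hi, hvi⟩, fun j hj _ _ h' => h' fun x hxj hx => h hx j hj hxj⟩

lemma NearRegular.sum_card_edgesAt (H : NearRegular e W E r d θ C) :
    ∑ v ∈ W, (#(edgesAt e E v) : ℝ) = r * #E := by
  unfold edgesAt
  simp_rw [card_filter]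
  push_cast
  rw [sum_comm, mul_comm, ← nsmul_eq_mul, ← sum_const]
  refine sum_congr rfl fun i hi => ?_
  rw [sum_boole, filter_mem_eq_inter, inter_eq_right.2 (H.subset i hi), H.card_eq i hi]

lemma NearRegular.mean_cost_le (H : NearRegular e W E r d θ C) (hr : 1 ≤ r) (hε : 0 < ε)
    (hd : 0 < d) (hθ1 : θ ≤ 1) (hp : ε / d ≤ 1 / 2) {η b : ℝ} (hη : 0 ≤ η) (hη1 : η ≤ 1)
    (hεη : 6 * ε ≤ η) (hb : 0 ≤ b) :
    bernoulliMean (ε / d) E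
      (fun S => (#S : ℝ) + ((1 + η) / r + b) *
        ∑ v ∈ W, if Disjoint S (edgesAt e E v) then 1 else 0) ≤
      ((1 + η) / r + b * Real.exp (-(ε / 3))) * #W := by
  have hr' : (1 : ℝ) ≤ r := by exact_mod_cast hr
  set p := ε / d with hpd
  have hp0 : 0 < p := by positivity
  have hpe : p * d = ε := by rw [hpd]; field_simp
  rw [bernoulliMean_add, bernoulliMean_card, bernoulliMean_const_mul, bernoulliMean_sum]
  simp_rw [bernoulliMean_disjoint]
  have hm : ∀ v ∈ W, ε / 3 ≤ p * #(edgesAt e E v) ∧ p * #(edgesAt e E v) ≤ 3 * ε := by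
    intro v hv
    have h1 := H.le_deg v hv
    have h2 := H.deg_le v hv
    have h3 := exp_le_three hθ1
    have h4 : 1 / 3 ≤ Real.exp (-θ) := by
      rw [Real.exp_neg, ← one_div]
      exact one_div_le_one_div_of_le (Real.exp_pos _) h3
    constructor
    · calc ε / 3 = p * (d * (1 / 3)) := by rw [← hpe]; ring
        _ ≤ p * (d * Real.exp (-θ)) := by gcongr
        _ ≤ _ := by gcongr
    · calc p * #(edgesAt e E v) ≤ p * (d * Real.exp θ) := by gcongr
        _ ≤ p * (d * 3) := by gcongr
        _ = _ := by rw [← hpe]; ring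
  have hle : ∀ v ∈ W, (1 - p) ^ #(E ∩ edgesAt e E v) ≤ Real.exp (-(p * #(edgesAt e E v))) := by
    intro v _
    rw [inter_eq_right.2 (show edgesAt e E v ⊆ E from filter_subset _ _)]
    exact one_sub_pow_le_exp (by linarith) _
  have hA : ∑ v ∈ W, (1 - p) ^ #(E ∩ edgesAt e E v) ≤ Real.exp (-(ε / 3)) * #W := by
    rw [mul_comm, ← nsmul_eq_mul, ← sum_const]
    refine sum_le_sum fun v hv => (hle v hv).trans (Real.exp_le_exp.2 ?_)
    linarith [(hm v hv).1]
  have hB : ∑ v ∈ W, (1 - p) ^ #(E ∩ edgesAt e E v) ≤ #W - (1 - 3 * ε) * p * (r * #E) := by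
    rw [← H.sum_card_edgesAt, mul_sum]
    have : (#W : ℝ) = ∑ _v ∈ W, (1 : ℝ) := by simp
    rw [this, ← sum_sub_distrib]
    refine sum_le_sum fun v hv => (hle v hv).trans ?_
    obtain ⟨h1, h2⟩ := hm v hv
    set x := p * (#(edgesAt e E v) : ℝ) with hx
    have hx0 : 0 ≤ x := by positivity
    have h3 := (abs_le.1 (Real.abs_exp_sub_one_sub_id_le (x := -x)
      (by rw [abs_neg, abs_of_nonneg hx0]; linarith))).2
    rw [mul_assoc, ← hx]
    nlinarith
  have hC1 : b * ∑ v ∈ W, (1 - p) ^ #(E ∩ edgesAt e E v) ≤ b * (Real.exp (-(ε / 3)) * #W) :=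
    mul_le_mul_of_nonneg_left hA hb
  have hD : (1 + η) / r * ∑ v ∈ W, (1 - p) ^ #(E ∩ edgesAt e E v) ≤
      (1 + η) / r * (#W - (1 - 3 * ε) * p * (r * #E)) :=
    mul_le_mul_of_nonneg_left hB (by positivity)
  have hF : (1 + η) / r * ((1 - 3 * ε) * p * (r * #E)) = (1 + η) * (1 - 3 * ε) * (p * #E) := by
    field_simp
  have hG : 1 * (p * #E) ≤ (1 + η) * (1 - 3 * ε) * (p * #E) :=
    mul_le_mul_of_nonneg_right (by nlinarith) (by positivity)
  linarith

lemma abs_le_of_exp_add_exp_lt {l x m : ℝ} (hl : 0 < l)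
    (h : Real.exp (-l * m) * (Real.exp (1 * l * x) + Real.exp (-1 * l * x)) < 1) : |x| ≤ m := by
  have key : ∀ y, Real.exp (-l * m) * Real.exp (l * y) < 1 → y ≤ m := by
    intro y hy
    rw [← Real.exp_add, Real.exp_lt_one_iff] at hy
    nlinarith
  have h1 := mul_pos (Real.exp_pos (-l * m)) (Real.exp_pos (1 * l * x))
  have h2 := mul_pos (Real.exp_pos (-l * m)) (Real.exp_pos (-1 * l * x))
  rw [mul_add] at h
  refine abs_le'.2 ⟨key _ ?_, key _ ?_⟩
  · rw [one_mul] at h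
    linarith
  · rw [show l * -x = -1 * l * x by ring]
    linarith

lemma NearRegular.exists_concentrated (H : NearRegular e W E r d θ C) (hr : 1 ≤ r) (hε : 0 < ε)
    (hεr : ε * r ≤ 1 / 8) (hC : 0 < C) (hd : 0 < d) (hp : ε / d ≤ 1 / 2) (hτ : 0 < τ)
    (hτ1 : τ ≤ 1) (hθ1 : θ ≤ 1) {D Λ q η b : ℝ} (hD : d / 2 ≤ D)
    (hΛ : 144 * C * r * Λ ≤ d * τ ^ 2) (hq : 2 * #W * Real.exp (-Λ) ≤ q)
    (hq1 : q < 1 / 2) (hη : 0 ≤ η) (hη1 : η ≤ 1) (hεη : 6 * ε ≤ η) (hb : 0 ≤ b) :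
    ∃ S ⊆ E, (∀ v ∈ W, |unblocked e E v S - bernoulliMean (ε / d) E (unblocked e E v)| ≤ τ * D) ∧
      #S + ((1 + η) / r + b) * #(W \ S.biUnion e) ≤
        (1 + 2 * q) * (((1 + η) / r + b * Real.exp (-(ε / 3))) * #W) := by
  have hr' : (1 : ℝ) ≤ r := by exact_mod_cast hr
  have hp0 : 0 ≤ ε / d := by positivity
  set a := (1 + η) / r + b * Real.exp (-(ε / 3)) with ha
  have ha0 : 0 < a := by positivity
  set l := τ / (36 * r * C) with hl
  have hl0 : 0 < l := by positivity
  set μ := fun v => bernoulliMean (ε / d) E (unblocked e E v) with hμ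
  set cost : Finset ι → ℝ := fun S => (#S : ℝ) + ((1 + η) / r + b) *
    ∑ v ∈ W, if Disjoint S (edgesAt e E v) then 1 else 0 with hcost
  set Z : V → Finset ι → ℝ := fun v S => Real.exp (1 * l * (unblocked e E v S - μ v)) +
    Real.exp (-1 * l * (unblocked e E v S - μ v)) with hZ
  set w := 2 * (a * #W) * Real.exp (-l * (τ * D)) with hw
  have hw0 : 0 ≤ w := by positivity
  have hmean : bernoulliMean (ε / d) E (fun S => cost S + w * ∑ v ∈ W, Z v S) ≤
      (1 + 2 * q) * (a * #W) := by
    rw [bernoulliMean_add, bernoulliMean_const_mul, bernoulliMean_sum]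
    have h1 := H.mean_cost_le hr hε hd hθ1 hp hη hη1 hεη hb
    have h2 : Real.exp (-l * (τ * D)) * ∑ v ∈ W, bernoulliMean (ε / d) E (Z v) ≤ q := by
      refine le_trans ?_ hq
      rw [mul_sum]
      have : 2 * (#W : ℝ) * Real.exp (-Λ) = ∑ _v ∈ W, 2 * Real.exp (-Λ) := by
        rw [sum_const, nsmul_eq_mul]; ring
      rw [this]
      refine sum_le_sum fun v hv => ?_
      simp only [hZ]
      rw [bernoulliMean_add, mul_add, two_mul]
      have h3 := fun (σ : ℝ) (hσ : |σ| = 1) => H.mean_exp_le hC hd hθ1 hr hε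
        hεr hp hτ hτ1 hD hΛ hv hσ
      have h4 := h3 1 (by simp)
      have h5 := h3 (-1) (by simp)
      rw [mul_comm] at h4 h5
      exact add_le_add h4 h5
    have h6 : w * ∑ v ∈ W, bernoulliMean (ε / d) E (Z v) ≤ 2 * (a * #W) * q := by
      rw [hw, mul_assoc]
      exact mul_le_mul_of_nonneg_left h2 (by positivity)
    calc _ ≤ a * #W + 2 * (a * #W) * q := add_le_add h1 h6
      _ = _ := by ring
  obtain ⟨S, hS, hSle⟩ := exists_le_bernoulliMean (E := E) hp0 (by linarith)
    (fun S => cost S + w * ∑ v ∈ W, Z v S)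
  have hSle := hSle.trans hmean
  have hZ0 : ∀ v, 0 ≤ Z v S := fun v => by positivity
  have hcost0 : 0 ≤ cost S :=
    add_nonneg (Nat.cast_nonneg _) (mul_nonneg (by positivity)
      (sum_nonneg fun v _ => by split_ifs <;> norm_num))
  refine ⟨S, hS, fun v hv => ?_, ?_⟩
  · have hW : (0 : ℝ) < #W := by exact_mod_cast card_pos.2 ⟨v, hv⟩
    have haW : 0 < a * #W := mul_pos ha0 hW
    have h1 : Z v S ≤ ∑ v ∈ W, Z v S :=
      single_le_sum (f := fun v => Z v S) (fun v _ => hZ0 v) hv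
    have h2 : (a * #W) * (2 * (Real.exp (-l * (τ * D)) * Z v S)) ≤ (a * #W) * (1 + 2 * q) := by
      calc (a * #W) * (2 * (Real.exp (-l * (τ * D)) * Z v S)) = w * Z v S := by rw [hw]; ring
        _ ≤ w * ∑ v ∈ W, Z v S := mul_le_mul_of_nonneg_left h1 hw0
        _ ≤ _ := by linarith
    have h3 := le_of_mul_le_mul_left h2 haW
    exact abs_le_of_exp_add_exp_lt hl0 (by linarith)
  · have hcard : ∑ v ∈ W, (if Disjoint S (edgesAt e E v) then (1 : ℝ) else 0) =
        #(W \ S.biUnion e) := by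
      rw [sum_boole]
      congr 2
      ext v
      rw [mem_filter, mem_sdiff, disjoint_edgesAt_iff hS]
    rw [← hcard]
    refine le_trans ?_ hSle
    have : 0 ≤ w * ∑ v ∈ W, Z v S := mul_nonneg hw0 (sum_nonneg fun v _ => hZ0 v)
    linarith

lemma NearRegular.residual (H : NearRegular e W E r d θ C) (hr : 1 ≤ r) (hε : 0 < ε)
    (hεr : ε * r ≤ 1 / 8) (hC : 0 ≤ C) (hd : 0 < d) (hθ : 0 ≤ θ) (hτ : 0 < τ)
    (hθτ : 2 * (θ + 7 * τ) ≤ 1) (hp : ε / d ≤ 1 / 2) (hpτ : ε / d ≤ τ) (hCr : r * C ≤ τ * d)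
    {S : Finset ι} (hS : S ⊆ E)
    (hdev : ∀ v ∈ W, |unblocked e E v S - bernoulliMean (ε / d) E (unblocked e E v)| ≤
      τ * (d * Real.exp (-(ε * (r - 1))))) :
    NearRegular e (W \ S.biUnion e) {i ∈ E | Disjoint (e i) (S.biUnion e)} r
      (d * Real.exp (-(ε * (r - 1)))) (2 * θ + 7 * τ) C := by
  set D := d * Real.exp (-(ε * (r - 1))) with hD
  have hD0 : 0 < D := by positivity
  set y := 5 / 4 * θ + τ with hy
  have hy1 : y ≤ 1 := by linarith
  have hy0 : 0 ≤ y := by positivity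
  refine ⟨?_, ?_, ?_, ?_, ?_⟩
  · intro i hi
    rw [mem_filter] at hi
    exact subset_sdiff.2 ⟨H.subset i hi.1, hi.2⟩
  · exact fun i hi => H.card_eq i (mem_filter.1 hi).1
  · intro v hv
    rw [mem_sdiff] at hv
    rw [← unblocked_eq_card hS hv.2]
    have h1 := (abs_le.1 (hdev v hv.1)).1
    have h2 := H.le_mean hr hε hεr hd hθ (by linarith) hp hpτ hv.1
    have h3 : Real.exp (-(2 * θ + 7 * τ)) ≤ Real.exp (-y) - τ := by
      have h4 : Real.exp (-(2 * θ + 7 * τ)) ≤ Real.exp (-y) * Real.exp (-(6 * τ)) := by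
        rw [← Real.exp_add]
        exact Real.exp_le_exp.2 (by linarith)
      have h5 : Real.exp (-(6 * τ)) ≤ 1 - 3 * τ := by
        have := (abs_le.1 (Real.abs_exp_sub_one_sub_id_le (x := -(6 * τ))
          (by rw [abs_neg, abs_of_nonneg] <;> linarith))).2
        nlinarith
      have h6 : 1 / 3 ≤ Real.exp (-y) := by
        rw [Real.exp_neg, ← one_div]
        exact one_div_le_one_div_of_le (Real.exp_pos _) (exp_le_three hy1)
      nlinarith
    have h7 : D * Real.exp (-(2 * θ + 7 * τ)) ≤ D * (Real.exp (-y) - τ) :=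
      mul_le_mul_of_nonneg_left h3 hD0.le
    linarith
  · intro v hv
    rw [mem_sdiff] at hv
    rw [← unblocked_eq_card hS hv.2]
    have h1 := (abs_le.1 (hdev v hv.1)).2
    have h2 := H.mean_le (τ := τ) hr hε hεr hd hθ hp (by linarith) hCr hv.1
    have h3 : Real.exp y + τ ≤ Real.exp (2 * θ + 7 * τ) := by
      have h4 : Real.exp y * Real.exp τ ≤ Real.exp (2 * θ + 7 * τ) := by
        rw [← Real.exp_add]
        exact Real.exp_le_exp.2 (by linarith)
      have h5 := Real.add_one_le_exp τ
      have h6 := Real.one_le_exp hy0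
      nlinarith
    have h7 : D * (Real.exp y + τ) ≤ D * Real.exp (2 * θ + 7 * τ) :=
      mul_le_mul_of_nonneg_left h3 hD0.le
    linarith
  · intro u v huv
    refine le_trans ?_ (H.codeg_le u v huv)
    have h1 : ∀ w, edgesAt e {i ∈ E | Disjoint (e i) (S.biUnion e)} w ⊆ edgesAt e E w :=
      fun w => filter_subset_filter _ (filter_subset _ _)
    exact_mod_cast card_le_card (inter_subset_inter (h1 u) (h1 v))

lemma NearRegular.exists_bite (H : NearRegular e W E r d θ C) (hr : 1 ≤ r) (hε : 0 < ε)
    (hεr : ε * r ≤ 1 / 8) (hC : 1 ≤ C) (hτ : 0 < τ) (hθ : 0 ≤ θ) (hθτ : 2 * (θ + 7 * τ) ≤ 1)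
    {Λ q η b : ℝ} (hΛ1 : 1 ≤ Λ) (hΛ : 144 * C * r * Λ ≤ d * τ ^ 2) (hq : 2 * #W * Real.exp (-Λ) ≤ q)
    (hq1 : q < 1 / 2) (hη : 0 ≤ η) (hη1 : η ≤ 1) (hεη : 6 * ε ≤ η) (hb : 0 ≤ b) :
    ∃ S ⊆ E, NearRegular e (W \ S.biUnion e) {i ∈ E | Disjoint (e i) (S.biUnion e)} r
        (d * Real.exp (-(ε * (r - 1)))) (2 * θ + 7 * τ) C ∧
      #S + ((1 + η) / r + b) * #(W \ S.biUnion e) ≤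
        (1 + 2 * q) * (((1 + η) / r + b * Real.exp (-(ε / 3))) * #W) := by
  have hr' : (1 : ℝ) ≤ r := by exact_mod_cast hr
  have hτ1 : τ ≤ 1 / 14 := by linarith
  have hCr : r * C ≤ τ * d := by
    have h1 : C * r * 1 ≤ C * r * Λ := mul_le_mul_of_nonneg_left hΛ1 (by positivity)
    have h2 : r * C ≤ τ * (τ * d) := by nlinarith
    have h3 : 0 < τ * d := by
      by_contra! h
      nlinarith
    nlinarith
  have hd : 0 < d := by
    by_contra! h
    nlinarith
  have hε1 : ε ≤ 1 / 8 := by nlinarith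
  have hpτ : ε / d ≤ τ := by
    rw [div_le_iff₀ hd]
    nlinarith
  have hp : ε / d ≤ 1 / 2 := by linarith
  have hD2 : d / 2 ≤ d * Real.exp (-(ε * (r - 1))) := by
    have := Real.one_sub_le_exp_neg (ε * (r - 1))
    nlinarith
  obtain ⟨S, hS, hdev, hle⟩ := H.exists_concentrated hr hε hεr (by linarith) hd hp hτ (by linarith)
    (by linarith) hD2 hΛ hq hq1 hη hη1 hεη hb
  exact ⟨S, hS, H.residual hr hε hεr (by linarith) hd hθ hτ hθτ hp hpτ hCr hS hdev, hle⟩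

end Bite

section Cover

variable {ι V : Type*} [DecidableEq ι] [DecidableEq V]
variable {e : ι → Finset V} {W : Finset V} {E : Finset ι} {r : ℕ} {d θ C ε τ : ℝ}

lemma NearRegular.exists_cover_of_bite (H : NearRegular e W E r d θ C) (hr : 1 ≤ r) (hd : 0 < d)
    (hθ1 : θ ≤ 1) {t : ℝ} (ht : 0 ≤ t) (htd : 3 * t ≤ d) :
    ∃ S ⊆ E, (∀ v ∈ W, ∃ i ∈ S, v ∈ e i) ∧ (#S : ℝ) ≤ (9 * t / r + Real.exp (-t)) * #W := by
  obtain rfl | hW := W.eq_empty_or_nonempty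
  · exact ⟨∅, empty_subset _, by simp, by simp⟩
  have hr' : (1 : ℝ) ≤ r := by exact_mod_cast hr
  set p := 3 * t / d with hp
  have hp0 : 0 ≤ p := by positivity
  have hp1 : p ≤ 1 := by rw [hp, div_le_one hd]; exact htd
  have hpd : p * d = 3 * t := by rw [hp]; field_simp
  obtain ⟨S, hS, hle⟩ := exists_le_bernoulliMean (E := E) hp0 hp1
    (fun S => (#S : ℝ) + ∑ v ∈ W, if Disjoint S (edgesAt e E v) then 1 else 0)
  rw [bernoulliMean_add, bernoulliMean_card, bernoulliMean_sum] at hle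
  simp_rw [bernoulliMean_disjoint] at hle
  have h3 := exp_le_three hθ1
  have h4 : 1 / 3 ≤ Real.exp (-θ) := by
    rw [Real.exp_neg, ← one_div]
    exact one_div_le_one_div_of_le (Real.exp_pos _) h3
  have hlow : ∀ v ∈ W, d / 3 ≤ #(edgesAt e E v) := fun v hv =>
    le_trans (by nlinarith) (H.le_deg v hv)
  have h5 : ∑ v ∈ W, (1 - p) ^ #(E ∩ edgesAt e E v) ≤ Real.exp (-t) * #W := by
    rw [mul_comm, ← nsmul_eq_mul, ← sum_const]
    refine sum_le_sum fun v hv => ?_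
    rw [inter_eq_right.2 (show edgesAt e E v ⊆ E from filter_subset _ _)]
    refine (one_sub_pow_le_exp hp1 _).trans (Real.exp_le_exp.2 ?_)
    nlinarith [mul_le_mul_of_nonneg_left (hlow v hv) hp0]
  have h6 : p * #E ≤ 9 * t / r * #W := by
    have h7 : (r : ℝ) * #E ≤ d * 3 * #W := by
      rw [← H.sum_card_edgesAt, mul_comm, ← nsmul_eq_mul, ← sum_const]
      exact sum_le_sum fun v hv => (H.deg_le v hv).trans (by gcongr)
    rw [show 9 * t / r * #W = 9 * t * #W / r by ring, le_div_iff₀ (by linarith)]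
    calc p * #E * r = p * (r * #E) := by ring
      _ ≤ p * (d * 3 * #W) := by gcongr
      _ = 9 * t * #W := by rw [show p * (d * 3 * #W) = (p * d) * 3 * #W by ring, hpd]; ring
  have hex : ∀ v ∈ W, ∃ i, i ∈ edgesAt e E v := by
    intro v hv
    have h8 : (0 : ℝ) < #(edgesAt e E v) := lt_of_lt_of_le (by positivity) (hlow v hv)
    exact card_pos.1 (by exact_mod_cast h8)
  obtain ⟨φ, hφ⟩ : ∃ φ : V → ι, ∀ v ∈ W, φ v ∈ edgesAt e E v := by
    obtain ⟨v, hv⟩ := hW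
    have : Nonempty ι := ⟨(hex v hv).choose⟩
    choose! φ hφ using hex
    exact ⟨φ, hφ⟩
  have hcard : ∑ v ∈ W, (if Disjoint S (edgesAt e E v) then (1 : ℝ) else 0) =
      #{v ∈ W | Disjoint S (edgesAt e E v)} := by rw [sum_boole]
  rw [hcard] at hle
  refine ⟨S ∪ image φ {v ∈ W | Disjoint S (edgesAt e E v)}, union_subset hS ?_, ?_, ?_⟩
  · intro i hi
    obtain ⟨v, hv, rfl⟩ := mem_image.1 hi
    exact (mem_edgesAt.1 (hφ v (mem_filter.1 hv).1)).1
  · intro v hv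
    by_cases h : Disjoint S (edgesAt e E v)
    · exact ⟨φ v, mem_union_right _ (mem_image_of_mem _ (mem_filter.2 ⟨hv, h⟩)),
        (mem_edgesAt.1 (hφ v hv)).2⟩
    · obtain ⟨i, hi, hi'⟩ := not_disjoint_iff.1 h
      exact ⟨i, mem_union_left _ hi, (mem_edgesAt.1 hi').2⟩
  · have h9 : (#(S ∪ image φ {v ∈ W | Disjoint S (edgesAt e E v)}) : ℝ) ≤
        #S + #{v ∈ W | Disjoint S (edgesAt e E v)} := by
      exact_mod_cast (card_union_le _ _).trans (Nat.add_le_add_left card_image_le _)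
    linarith

/-- The nibble: `s` small bites followed by a large one. -/
theorem NearRegular.exists_cover {Λ q η t : ℝ} (hr : 1 ≤ r) (hε : 0 < ε)
    (hεr : ε * r ≤ 1 / 8) (hC : 1 ≤ C) (hτ : 0 < τ) (hΛ1 : 1 ≤ Λ) (hq1 : q < 1 / 2)
    (hη : 0 ≤ η) (hη1 : η ≤ 1) (hεη : 6 * ε ≤ η) (ht : 0 ≤ t) (htΛ : 3 * t ≤ Λ) (s : ℕ) :
    ∀ (W : Finset V) (E : Finset ι) (d θ : ℝ), NearRegular e W E r d θ C → 0 ≤ θ →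
      (θ + 7 * τ) * 2 ^ s ≤ 1 → 144 * C * r * Λ * 2 ^ s ≤ d * τ ^ 2 →
      2 * #W * Real.exp (-Λ) ≤ q →
      ∃ S ⊆ E, (∀ v ∈ W, ∃ i ∈ S, v ∈ e i) ∧
        (#S : ℝ) ≤ (1 + 2 * q) ^ s * (((1 + η) / r +
          (9 * t / r + Real.exp (-t)) * Real.exp (-(ε / 3)) ^ s) * #W) := by
  have hr' : (1 : ℝ) ≤ r := by exact_mod_cast hr
  induction s with
  | zero =>
    intro W E d θ H hθ hθτ hΛ hq
    have h1 : 1 * 1 ≤ C * r := mul_le_mul hC hr' (by norm_num) (by linarith)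
    have h2 : 1 * Λ ≤ C * r * Λ := mul_le_mul_of_nonneg_right (by linarith) (by linarith)
    have h3 : Λ ≤ d * τ ^ 2 := by linarith
    have h4 : 0 < d := by
      by_contra! h
      nlinarith [sq_nonneg τ]
    have h5 : d * τ ^ 2 ≤ d * 1 := mul_le_mul_of_nonneg_left (by nlinarith) h4.le
    obtain ⟨S, hS, hcov, hle⟩ := H.exists_cover_of_bite hr h4 (by linarith) ht (by linarith)
    refine ⟨S, hS, hcov, hle.trans ?_⟩
    rw [pow_zero, pow_zero, one_mul, mul_one]
    refine mul_le_mul_of_nonneg_right ?_ (Nat.cast_nonneg _)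
    have : 0 ≤ (1 + η) / r := by positivity
    linarith
  | succ s ih =>
    intro W E d θ H hθ hθτ hΛ hq
    have h2s : (1 : ℝ) ≤ 2 ^ s := one_le_pow₀ (by norm_num)
    have hq0 : 0 ≤ q := le_trans (by positivity) hq
    rw [pow_succ] at hθτ hΛ
    have hθτ' : 2 * (θ + 7 * τ) ≤ 1 := by nlinarith
    have hX : 0 ≤ 144 * C * r * Λ := by positivity
    set b := (9 * t / r + Real.exp (-t)) * Real.exp (-(ε / 3)) ^ s with hb
    obtain ⟨S₁, hS₁, H', hle₁⟩ := H.exists_bite hr hε hεr hC hτ hθ hθτ' hΛ1 (by nlinarith) hq hq1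
      hη hη1 hεη (b := b) (by positivity)
    have hd : 0 ≤ d := by
      by_contra! h
      have h1 := mul_neg_of_neg_of_pos h (pow_pos hτ 2)
      have h2 : 0 ≤ 144 * C * r * Λ * (2 ^ s * 2) := by positivity
      linarith
    have hd' : d / 2 ≤ d * Real.exp (-(ε * (r - 1))) := by
      have := Real.one_sub_le_exp_neg (ε * (r - 1))
      nlinarith
    obtain ⟨S₂, hS₂, hcov, hle₂⟩ := ih _ _ _ _ H' (by positivity) (by linarith)
      (by nlinarith [mul_le_mul_of_nonneg_right hd' (sq_nonneg τ)])
      (le_trans (by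
        have : (#(W \ S₁.biUnion e) : ℝ) ≤ #W := by exact_mod_cast card_le_card sdiff_subset
        gcongr) hq)
    refine ⟨S₁ ∪ S₂, union_subset hS₁ (hS₂.trans (filter_subset _ _)), ?_, ?_⟩
    · intro v hv
      by_cases h : v ∈ S₁.biUnion e
      · obtain ⟨i, hi, hvi⟩ := mem_biUnion.1 h
        exact ⟨i, mem_union_left _ hi, hvi⟩
      · obtain ⟨i, hi, hvi⟩ := hcov v (mem_sdiff.2 ⟨hv, h⟩)
        exact ⟨i, mem_union_right _ hi, hvi⟩
    · have h1 : (#(S₁ ∪ S₂) : ℝ) ≤ #S₁ + #S₂ := by exact_mod_cast card_union_le _ _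
      have h2 : (1 : ℝ) ≤ (1 + 2 * q) ^ s := one_le_pow₀ (by linarith)
      have h3 : (#S₁ : ℝ) ≤ (1 + 2 * q) ^ s * #S₁ := le_mul_of_one_le_left (Nat.cast_nonneg _) h2
      have h4 : (1 + 2 * q) ^ s * (#S₁ + ((1 + η) / r + b) * #(W \ S₁.biUnion e)) ≤
          (1 + 2 * q) ^ s * ((1 + 2 * q) * (((1 + η) / r + b * Real.exp (-(ε / 3))) * #W)) :=
        mul_le_mul_of_nonneg_left hle₁ (by linarith)
      rw [pow_succ (1 + 2 * q), pow_succ (Real.exp _), ← mul_assoc _ _ (Real.exp (-(ε / 3))), ← hb]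
      linarith

end Cover

section Covering

variable {α : Type*} [Fintype α] [DecidableEq α]

lemma nearRegular_powersetCard (α : Type*) [Fintype α] [DecidableEq α] {k : ℕ} (hk : 1 ≤ k) :
    NearRegular (fun A : Finset α => powersetCard k A) (powersetCard k univ)
      (powersetCard (2 * k) univ) ((2 * k).choose k) ((Fintype.card α - k).choose k) 0
      ((Fintype.card α - k - 1).choose (k - 1) : ℕ) := by
  have hdeg : ∀ v ∈ powersetCard k (univ : Finset α),
      #(edgesAt (fun A : Finset α => powersetCard k A) (powersetCard (2 * k) univ) v) =
        (Fintype.card α - k).choose k := by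
    intro v hv
    rw [mem_powersetCard_univ] at hv
    have h := card_filter_powersetCard_subset v univ (2 * k) (subset_univ v) (by omega)
    rw [card_univ, hv, show 2 * k - k = k by omega] at h
    rw [← h, edgesAt]
    congr 1
    ext A
    simp [hv]
  refine ⟨fun A _ => powersetCard_mono (subset_univ A), fun A hA => ?_, fun v hv => ?_,
    fun v hv => ?_, fun u v huv => ?_⟩
  · rw [card_powersetCard, mem_powersetCard_univ.1 hA]
  · rw [hdeg v hv]
    simp
  · rw [hdeg v hv]
    simp
  · rw [Nat.cast_le]
    by_cases h : #u = k ∧ #v = k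
    · obtain ⟨hu, hv⟩ := h
      have h1 : ¬v ⊆ u := fun h => huv (eq_of_subset_of_card_le h (by omega)).symm
      obtain ⟨x, hxv, hxu⟩ := not_subset.1 h1
      have h2 := card_filter_powersetCard_subset (insert x u) univ (2 * k) (subset_univ _)
        (by rw [card_insert_of_notMem hxu]; omega)
      rw [card_univ, card_insert_of_notMem hxu, hu, show 2 * k - (k + 1) = k - 1 by omega,
        ← Nat.sub_sub] at h2
      rw [← h2]
      refine card_le_card fun A hA => ?_
      simp only [mem_inter, mem_edgesAt, mem_powersetCard] at hA
      simp only [mem_filter, mem_powersetCard]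
      exact ⟨hA.1.1, insert_subset (hA.2.2.1 hxv) hA.1.2.1⟩
    · rw [card_eq_zero.2]
      · exact Nat.zero_le _
      · refine eq_empty_of_forall_notMem fun A hA => h ?_
        simp only [mem_inter, mem_edgesAt, mem_powersetCard] at hA
        exact ⟨hA.1.2.2, hA.2.2.2⟩

lemma card_inter_eq_card_inter_compl_iff {A P : Finset α} (hA : #A = 2 * #P) :
    #(A ∩ P) = #(A ∩ Pᶜ) ↔ P ⊆ A := by
  have h := card_inter_add_card_sdiff A P
  rw [← sdiff_eq_inter_compl]
  constructor
  · intro h1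
    exact inter_eq_right.1 (eq_of_subset_of_card_le inter_subset_right (by omega))
  · intro h1
    rw [inter_eq_right.2 h1] at h ⊢
    omega

end Covering

lemma gammaE_le {n k : ℕ} {S : Finset (Finset (Fin n))} (hS : S ⊆ powersetCard (2 * k) univ)
    (hcov : ∀ P ∈ powersetCard k univ, ∃ A ∈ S, P ∈ powersetCard k A) :
    gammaE n k (2 * k) ≤ #S := by
  refine Nat.sInf_le ⟨S, rfl, fun A hA => mem_powersetCard_univ.1 (hS hA), fun P hP => ?_⟩
  obtain ⟨A, hA, hPA⟩ := hcov P (mem_powersetCard_univ.2 hP)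
  refine ⟨A, hA, (card_inter_eq_card_inter_compl_iff ?_).2 (mem_powersetCard.1 hPA).1⟩
  rw [hP, mem_powersetCard_univ.1 (hS hA)]

lemma exists_card_eq_gammaE {n k : ℕ} (h : 2 * k ≤ n) :
    ∃ 𝒜 : Finset (Finset (Fin n)), #𝒜 = gammaE n k (2 * k) ∧
      (∀ A ∈ 𝒜, #A = 2 * k) ∧ ∀ P : Finset (Fin n), #P = k → ∃ A ∈ 𝒜, P ⊆ A := by
  obtain ⟨𝒜, h1, h2, h3⟩ := Nat.sInf_mem (s := {m | ∃ 𝒜 : Finset (Finset (Fin n)),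
    #𝒜 = m ∧ (∀ A ∈ 𝒜, #A = 2 * k) ∧
    (∀ P : Finset (Fin n), #P = k → ∃ A ∈ 𝒜, #(A ∩ P) = #(A ∩ Pᶜ))}) (by
      refine ⟨_, powersetCard (2 * k) univ, rfl, fun A => mem_powersetCard_univ.1, fun P hP => ?_⟩
      obtain ⟨A, hPA, -, hA⟩ := exists_subsuperset_card_eq (subset_univ P)
        (show #P ≤ 2 * k by omega) (by simpa using h)
      exact ⟨A, mem_powersetCard_univ.2 hA,
        (card_inter_eq_card_inter_compl_iff (by rw [hA, hP])).2 hPA⟩)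
  refine ⟨𝒜, h1, h2, fun P hP => ?_⟩
  obtain ⟨A, hA, hAP⟩ := h3 P hP
  exact ⟨A, hA, (card_inter_eq_card_inter_compl_iff (by rw [h2 A hA, hP])).1 hAP⟩

lemma choose_le_gammaE_mul_choose {n k : ℕ} (h : 2 * k ≤ n) :
    n.choose k ≤ gammaE n k (2 * k) * (2 * k).choose k := by
  obtain ⟨𝒜, h1, h2, h3⟩ := exists_card_eq_gammaE h
  have hsub : powersetCard k (univ : Finset (Fin n)) ⊆ 𝒜.biUnion (powersetCard k) := by
    intro P hP
    obtain ⟨A, hA, hPA⟩ := h3 P (mem_powersetCard_univ.1 hP)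
    exact mem_biUnion.2 ⟨A, hA, mem_powersetCard.2 ⟨hPA, mem_powersetCard_univ.1 hP⟩⟩
  have h4 := (card_le_card hsub).trans (card_biUnion_le_card_mul 𝒜 _ ((2 * k).choose k)
    fun A hA => by rw [card_powersetCard, h2 A hA])
  rwa [card_powersetCard, card_univ, Fintype.card_fin, h1] at h4

section Parameters

lemma choose_two_mul_le_four_pow (k : ℕ) : (2 * k).choose k ≤ 4 ^ k := by
  rw [show 4 = 2 ^ 2 by norm_num, ← pow_mul]
  exact Nat.choose_le_two_pow _ _

lemma sq_centralBinom_mul_le (k : ℕ) : k.centralBinom ^ 2 * (2 * k + 1) ≤ 16 ^ k := by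
  induction k with
  | zero => simp
  | succ k ih =>
    have h := Nat.succ_mul_centralBinom_succ k
    refine le_of_mul_le_mul_left ?_ (show 0 < (k + 1) ^ 2 by positivity)
    calc (k + 1) ^ 2 * ((k + 1).centralBinom ^ 2 * (2 * (k + 1) + 1))
        = ((k + 1) * (k + 1).centralBinom) ^ 2 * (2 * k + 3) := by ring
      _ = 4 * (2 * k + 1) * (2 * k + 3) * (k.centralBinom ^ 2 * (2 * k + 1)) := by rw [h]; ring
      _ ≤ 4 * (2 * k + 1) * (2 * k + 3) * 16 ^ k := by gcongr
      _ ≤ 16 * (k + 1) ^ 2 * 16 ^ k := Nat.mul_le_mul_right _ (by nlinarith)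
      _ = (k + 1) ^ 2 * 16 ^ (k + 1) := by ring

lemma choose_two_mul_mul_sqrt_le (k : ℕ) : ((2 * k).choose k : ℝ) * √k ≤ 4 ^ k := by
  refine le_of_sq_le_sq ?_ (by positivity)
  rw [mul_pow, Real.sq_sqrt (Nat.cast_nonneg k), ← pow_mul, mul_comm k 2, pow_mul]
  have h : (2 * k).choose k ^ 2 * k ≤ 16 ^ k := by
    refine le_trans ?_ (sq_centralBinom_mul_le k)
    rw [Nat.centralBinom_eq_two_mul_choose]
    gcongr
    omega
  norm_num
  exact_mod_cast h

lemma mul_choose_eq_mul_choose_pred {n k : ℕ} (hk : 1 ≤ k) (hn : k < n) :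
    k * (n - k).choose k = (n - k) * (n - k - 1).choose (k - 1) := by
  have h := Nat.add_one_mul_choose_eq (n - k - 1) (k - 1)
  rw [show n - k - 1 + 1 = n - k by omega, show k - 1 + 1 = k by omega] at h
  rw [h, mul_comm]

lemma exp_neg_two_mul_le {k : ℕ} (hk : 1 ≤ k) :
    Real.exp (-(2 * k)) ≤ k / (2 * k).choose k := by
  have hk1 : (1 : ℝ) ≤ k := by exact_mod_cast hk
  have hr1 : (0 : ℝ) < (2 * k).choose k := by exact_mod_cast Nat.choose_pos (by omega)
  have h1 : ((2 * k).choose k : ℝ) ≤ Real.exp (2 * k) := by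
    calc ((2 * k).choose k : ℝ) ≤ 4 ^ k := by exact_mod_cast choose_two_mul_le_four_pow k
      _ ≤ Real.exp 2 ^ k := by
        gcongr
        have h2 := Real.add_one_le_exp (1 : ℝ)
        rw [show (2 : ℝ) = 1 + 1 by norm_num, Real.exp_add]
        nlinarith
      _ = Real.exp (2 * k) := by rw [← Real.exp_nat_mul, mul_comm]
  rw [Real.exp_neg, ← one_div]
  exact div_le_div₀ (by positivity) hk1 hr1 h1

lemma log_bounds_of_le_sqrt {n : ℕ} (h : 27 ≤ √(n : ℝ)) :
    6 ≤ Real.log n ∧ Real.log n ≤ 2 * √n := by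
  have hnn : √(n : ℝ) * √n = n := Real.mul_self_sqrt (Nat.cast_nonneg n)
  have hn : (729 : ℝ) ≤ n := by nlinarith
  constructor
  · rw [Real.le_log_iff_exp_le (by linarith)]
    calc Real.exp 6 = Real.exp 1 ^ 6 := by rw [← Real.exp_nat_mul]; norm_num
      _ ≤ (3 : ℝ) ^ 6 := by gcongr; exact Real.exp_one_lt_three.le
      _ ≤ n := by linarith
  · have h1 := Real.log_le_self (Real.sqrt_nonneg n)
    rw [Real.log_sqrt (Nat.cast_nonneg n)] at h1
    linarith

lemma codegree_mul_le_degree {n k s r : ℕ} {η : ℝ} (hk : 1 ≤ k) (hkn : 2 * k ≤ n) (hη : η ≤ 1)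
    (hlog : Real.log n ≤ 2 * √n)
    (hn : 28224 * r * (k * (k + 1)) * 8 ^ s ≤ √n * η) :
    144 * ((n - k - 1).choose (k - 1) : ℕ) * r * ((k + 1) * Real.log n) * 2 ^ s ≤
      ((n - k).choose k : ℕ) * (1 / (7 * 2 ^ s) : ℝ) ^ 2 := by
  have hk1 : (1 : ℝ) ≤ k := by exact_mod_cast hk
  have hkn' : (2 * k : ℝ) ≤ n := by exact_mod_cast hkn
  have h1 : (k : ℝ) * (n - k).choose k = (n - k) * (n - k - 1).choose (k - 1) := by
    have := mul_choose_eq_mul_choose_pred (n := n) hk (by omega)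
    rw [← Nat.cast_sub (by omega)]
    exact_mod_cast this
  generalize (((n - k).choose k : ℕ) : ℝ) = D at h1 ⊢
  have hC : (0 : ℝ) ≤ ((n - k - 1).choose (k - 1) : ℕ) := Nat.cast_nonneg _
  generalize (((n - k - 1).choose (k - 1) : ℕ) : ℝ) = C at h1 hC ⊢
  have hnn : √(n : ℝ) * √n = n := Real.mul_self_sqrt (Nat.cast_nonneg n)
  rw [div_pow, mul_pow, one_pow, mul_one_div, le_div_iff₀ (by positivity)]
  refine le_of_mul_le_mul_left (a := (k : ℝ)) ?_ (by linarith)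
  rw [h1]
  have h2 : (2 : ℝ) ^ s * (2 ^ s) ^ 2 = 8 ^ s := by
    rw [← pow_succ', ← pow_mul, mul_comm, pow_mul]; norm_num
  calc (k : ℝ) * (144 * C * r * ((k + 1) * Real.log n) * 2 ^ s * (7 ^ 2 * (2 ^ s) ^ 2))
      = 7056 * r * (k * (k + 1)) * (2 ^ s * (2 ^ s) ^ 2) * Real.log n * C := by ring
    _ ≤ 7056 * r * (k * (k + 1)) * 8 ^ s * (2 * √n) * C := by rw [h2]; gcongr
    _ = (28224 * r * (k * (k + 1)) * 8 ^ s * √n) / 2 * C := by ring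
    _ ≤ (√n * η * √n) / 2 * C := by gcongr
    _ = n * η / 2 * C := by rw [mul_right_comm, hnn]
    _ ≤ (n - k) * C := by
      refine mul_le_mul_of_nonneg_right ?_ hC
      have := mul_le_of_le_one_right (Nat.cast_nonneg (α := ℝ) n) hη
      linarith

lemma two_mul_choose_mul_exp_le {n k : ℕ} {q : ℝ} (hn : 0 < n) (h : 2 ≤ q * n) :
    2 * (n.choose k : ℝ) * Real.exp (-((k + 1) * Real.log n)) ≤ q := by
  have hn0 : (0 : ℝ) < n := by exact_mod_cast hn
  have h1 : (n.choose k : ℝ) ≤ n ^ k := by exact_mod_cast Nat.choose_le_pow n k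
  have h2 : Real.exp (-((k + 1) * Real.log n)) = ((n : ℝ) ^ (k + 1))⁻¹ := by
    rw [Real.exp_neg, ← Nat.cast_add_one, Real.exp_nat_mul, Real.exp_log hn0]
  rw [h2]
  calc 2 * (n.choose k : ℝ) * ((n : ℝ) ^ (k + 1))⁻¹ ≤ 2 * n ^ k * ((n : ℝ) ^ (k + 1))⁻¹ := by
        gcongr
    _ = 2 / n := by rw [pow_succ]; field_simp
    _ ≤ q := by rwa [div_le_iff₀ hn0]

lemma one_add_div_pow_le {s : ℕ} {η : ℝ} (hs : 1 ≤ s) (hη : 0 ≤ η) (hη1 : η ≤ 1) :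
    (1 + 2 * (η / (2 * s))) ^ s ≤ 1 + 2 * η := by
  have hs1 : (0 : ℝ) < s := by exact_mod_cast hs
  have h1 : (1 + 2 * (η / (2 * s))) ^ s ≤ Real.exp (η / s) ^ s := by
    refine pow_le_pow_left₀ (by positivity) ?_ s
    have := Real.add_one_le_exp (η / s)
    have h3 : 2 * (η / (2 * s)) = η / s := by field_simp
    linarith
  refine h1.trans ?_
  rw [← Real.exp_nat_mul, mul_div_cancel₀ _ hs1.ne']
  exact exp_le_one_add_two_mul hη hη1

theorem gammaE_le_of_bites {n k s : ℕ} {η : ℝ} (hk : 1 ≤ k) (hs : 1 ≤ s) (hη : 0 < η)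
    (hη1 : η ≤ 1 / 2)
    (hsη : 19 * k * Real.exp (-(η / (8 * (2 * k).choose k) / 3)) ^ s ≤ η)
    (hn : 28224 * (2 * k).choose k * (k * (k + 1)) * 8 ^ s / η ≤ √n) :
    (gammaE n k (2 * k) : ℝ) ≤ (1 + 8 * η) * (n.choose k / (2 * k).choose k) := by
  have hexp := exp_neg_two_mul_le hk
  have hr0 : 1 ≤ (2 * k).choose k := Nat.choose_pos (by omega)
  have hreg := nearRegular_powersetCard (Fin n) hk
  rw [Fintype.card_fin] at hreg
  generalize (2 * k).choose k = r at *
  have hr1 : (1 : ℝ) ≤ r := by exact_mod_cast hr0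
  have hk1 : (1 : ℝ) ≤ k := by exact_mod_cast hk
  have hs1 : (1 : ℝ) ≤ s := by exact_mod_cast hs
  have h8 : (s : ℝ) ≤ 8 ^ s := by exact_mod_cast (Nat.lt_pow_self (by norm_num : 1 < 8)).le
  rw [div_le_iff₀ hη] at hn
  have hsqrt0 : 0 ≤ √(n : ℝ) := Real.sqrt_nonneg _
  have hX : 1 * (1 * (k + 1 : ℝ)) * s ≤ r * (k * (k + 1)) * 8 ^ s := by gcongr
  have hbig : 28224 * ((k + 1 : ℝ) * s) ≤ √n * η := by linarith
  have hks : (k + 1 : ℝ) ≤ (k + 1) * s := le_mul_of_one_le_right (by positivity) hs1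
  have hsk : 2 * (s : ℝ) ≤ (k + 1) * s := by gcongr; linarith
  have hηs : √(n : ℝ) * η ≤ √n * (1 / 2) := by gcongr
  have hsqrt : 28224 * (k + 1 : ℝ) ≤ √n := by linarith
  have hsn : √(n : ℝ) ≤ n := by
    have hnn : √(n : ℝ) * √n = n := Real.mul_self_sqrt (Nat.cast_nonneg n)
    nlinarith
  have hsηn : √(n : ℝ) * η ≤ n * η := by gcongr
  have hkn : 2 * k ≤ n := by
    have : (2 * k : ℝ) ≤ n := by linarith
    exact_mod_cast this
  obtain ⟨hlog6, hlog⟩ := log_bounds_of_le_sqrt (n := n) (by linarith)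
  have hC : (1 : ℝ) ≤ ((n - k - 1).choose (k - 1) : ℕ) := by
    exact_mod_cast Nat.choose_pos (show k - 1 ≤ n - k - 1 by omega)
  have hΛ : (k + 1) * 6 ≤ (k + 1) * Real.log n := by gcongr
  have hq : 2 * (n.choose k : ℝ) * Real.exp (-((k + 1) * Real.log n)) ≤ η / (2 * s) :=
    two_mul_choose_mul_exp_le (by omega) (by
      rw [div_mul_eq_mul_div, le_div_iff₀ (by positivity)]
      linarith)
  have hεr : η / (8 * r) * r ≤ 1 / 8 := by
    rw [div_mul_eq_mul_div, div_le_iff₀ (by positivity)]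
    nlinarith
  have hε : 6 * (η / (8 * r)) ≤ η := by
    rw [mul_div_assoc', div_le_iff₀ (by positivity)]
    nlinarith
  have hτ : ((0 : ℝ) + 7 * (1 / (7 * 2 ^ s))) * 2 ^ s ≤ 1 := by
    field_simp
    norm_num
  have hq1 : η / (2 * s) < 1 / 2 := by
    rw [div_lt_iff₀ (by positivity)]
    linarith
  obtain ⟨S, hS, hSc, hle⟩ := NearRegular.exists_cover (ε := η / (8 * r)) (τ := 1 / (7 * 2 ^ s))
    (t := 2 * k) hr0 (by positivity) hεr hC (by positivity) (by linarith) hq1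
    hη.le (by linarith) hε (by positivity) (by linarith) s _ _ _ _ hreg le_rfl hτ
    (codegree_mul_le_degree hk hkn (by linarith) hlog hn)
    (by rw [card_powersetCard, card_univ, Fintype.card_fin]; exact hq)
  have hγ : (gammaE n k (2 * k) : ℝ) ≤ #S := by exact_mod_cast gammaE_le hS hSc
  refine hγ.trans (hle.trans ?_)
  rw [card_powersetCard, card_univ, Fintype.card_fin]
  have hpow := one_add_div_pow_le hs hη.le (by linarith)
  have hmain : (1 + η) / r + (9 * (2 * k) / r + Real.exp (-(2 * k))) *
      Real.exp (-(η / (8 * r) / 3)) ^ s ≤ (1 + 2 * η) / r := by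
    calc (1 + η) / r + (9 * (2 * k) / r + Real.exp (-(2 * k))) *
          Real.exp (-(η / (8 * r) / 3)) ^ s
        ≤ (1 + η) / r + (9 * (2 * k) / r + k / r) * Real.exp (-(η / (8 * r) / 3)) ^ s := by
          gcongr
      _ = (1 + η) / r + (19 * k * Real.exp (-(η / (8 * r) / 3)) ^ s) / r := by ring
      _ ≤ (1 + η) / r + η / r := by gcongr
      _ = (1 + 2 * η) / r := by ring
  calc _ ≤ (1 + 2 * η) * ((1 + 2 * η) / r * (n.choose k : ℝ)) := by gcongr
    _ = (1 + 2 * η) ^ 2 * (n.choose k / r) := by ring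
    _ ≤ (1 + 8 * η) * (n.choose k / r) := by
      gcongr
      nlinarith

end Parameters

section Asymptotics

open Filter Topology

/-- The number of bites used for `k`-sets with error `η`. -/
noncomputable def numBites (η : ℝ) (k : ℕ) : ℕ :=
  ⌈24 * (2 * k).choose k / η * Real.log (19 * k / η)⌉₊ + 1

lemma numBites_spec {η : ℝ} (hη : 0 < η) {k : ℕ} (hk : 1 ≤ k) :
    19 * k * Real.exp (-(η / (8 * (2 * k).choose k) / 3)) ^ numBites η k ≤ η := by
  have hk1 : (0 : ℝ) < k := by exact_mod_cast hk
  have hr1 : (0 : ℝ) < (2 * k).choose k := by exact_mod_cast Nat.choose_pos (by omega)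
  have hs : 24 * (2 * k).choose k / η * Real.log (19 * k / η) ≤ numBites η k := by
    rw [numBites, Nat.cast_add_one]
    exact (Nat.le_ceil _).trans (by linarith)
  generalize ((2 * k).choose k : ℝ) = r at *
  have h1 : Real.log (19 * k / η) ≤ numBites η k * (η / (8 * r) / 3) := by
    calc Real.log (19 * k / η) = 24 * r / η * Real.log (19 * k / η) * (η / (8 * r) / 3) := by
          field_simp
          ring
      _ ≤ _ := by gcongr
  rw [Real.log_le_iff_le_exp (by positivity), div_le_iff₀ hη] at h1
  rw [← Real.exp_nat_mul, mul_neg, Real.exp_neg, ← div_eq_mul_inv, div_le_iff₀ (Real.exp_pos _)]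
  linarith

lemma tendsto_log_div_sqrt {c : ℝ} (hc : 0 < c) :
    Tendsto (fun k : ℕ => Real.log (c * k) / √k) atTop (𝓝 0) := by
  have h1 : Tendsto (fun x : ℝ => Real.log x / x ^ (1 / 2 : ℝ)) atTop (𝓝 0) :=
    (isLittleO_log_rpow_atTop (by norm_num)).tendsto_div_nhds_zero
  have h2 : Tendsto (fun k : ℕ => c * (k : ℝ)) atTop atTop :=
    tendsto_natCast_atTop_atTop.const_mul_atTop hc
  have h3 := (h1.comp h2).const_mul √c
  rw [mul_zero] at h3
  refine h3.congr' ?_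
  filter_upwards [eventually_gt_atTop 0] with k hk
  have hk0 : (0 : ℝ) < √k := Real.sqrt_pos.2 (by exact_mod_cast hk)
  have hc0 : 0 < √c := Real.sqrt_pos.2 hc
  simp only [Function.comp_apply]
  rw [← Real.sqrt_eq_rpow, Real.sqrt_mul hc.le]
  field_simp

lemma mul_add_one_le_four_pow (k : ℕ) : k * (k + 1) ≤ 4 ^ k := by
  induction k with
  | zero => simp
  | succ k ih =>
    rcases k with _ | k
    · norm_num
    · rw [pow_succ]
      nlinarith

lemma eventually_threshold_le {η : ℝ} (hη : 0 < η) :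
    ∀ᶠ k : ℕ in atTop,
      28224 * (2 * k).choose k * (k * (k + 1)) * 8 ^ numBites η k / η ≤ (4 : ℝ) ^ 4 ^ k := by
  have h1 := (tendsto_log_div_sqrt (c := 19 / η) (by positivity)).const_mul
    (24 / η * Real.log 8)
  have h2 := ((tendsto_pow_const_div_const_pow_of_one_lt 0 (r := 4) (by norm_num)).const_mul
    (Real.log (28224 / η) + 2 * Real.log 8)).add
    ((tendsto_pow_const_div_const_pow_of_one_lt 1 (r := 4) (by norm_num)).const_mul
      (2 * Real.log 4))
  have h3 := h1.add h2
  simp only [mul_zero, add_zero] at h3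
  filter_upwards [h3.eventually_lt_const (Real.log_pos (by norm_num : (1 : ℝ) < 4)),
    eventually_gt_atTop 0, tendsto_natCast_atTop_atTop.eventually_ge_atTop η] with k hk hk0 hkη
  have hk1 : (1 : ℝ) ≤ k := by exact_mod_cast hk0
  have hr0 : (0 : ℝ) < (2 * k).choose k := by exact_mod_cast Nat.choose_pos (by omega)
  have hr1 : ((2 * k).choose k : ℝ) ≤ 4 ^ k := by exact_mod_cast choose_two_mul_le_four_pow k
  have hr2 := choose_two_mul_mul_sqrt_le k
  have hkk : (k * (k + 1) : ℝ) ≤ 4 ^ k := by exact_mod_cast mul_add_one_le_four_pow k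
  have hsq : (0 : ℝ) < √k := Real.sqrt_pos.2 (by linarith)
  have hlog0 : 0 ≤ Real.log (19 / η * k) := by
    refine Real.log_nonneg ?_
    rw [div_mul_eq_mul_div, one_le_div hη]
    linarith
  have hlog8 : 0 < Real.log 8 := Real.log_pos (by norm_num)
  have hs : (numBites η k : ℝ) ≤ 24 / η * (4 ^ k * (Real.log (19 / η * k) / √k)) + 2 := by
    have h4 : (2 * k).choose k ≤ (4 : ℝ) ^ k / √k := by rwa [le_div_iff₀ hsq]
    have h5 : 24 * (2 * k).choose k / η * Real.log (19 * k / η) ≤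
        24 / η * (4 ^ k * (Real.log (19 / η * k) / √k)) := by
      calc 24 * (2 * k).choose k / η * Real.log (19 * k / η)
          = 24 / η * ((2 * k).choose k * Real.log (19 / η * k)) := by
            rw [div_mul_eq_mul_div (19 : ℝ)]; ring
        _ ≤ 24 / η * (4 ^ k / √k * Real.log (19 / η * k)) := by gcongr
        _ = _ := by ring
    rw [numBites, Nat.cast_add_one]
    have h6 := (Nat.ceil_lt_add_one (a := 24 * (2 * k).choose k / η * Real.log (19 * k / η)) (by
      rw [← div_mul_eq_mul_div (19 : ℝ)]
      positivity)).le
    linarith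
  rw [← Real.log_le_log_iff (by positivity) (by positivity), Real.log_pow]
  calc Real.log (28224 * (2 * k).choose k * (k * (k + 1)) * 8 ^ numBites η k / η)
      ≤ Real.log (28224 / η * (4 ^ k * 4 ^ k) * 8 ^ numBites η k) := by
        refine Real.log_le_log (by positivity) ?_
        calc 28224 * (2 * k).choose k * (k * (k + 1)) * 8 ^ numBites η k / η
            = 28224 / η * ((2 * k).choose k * (k * (k + 1))) * 8 ^ numBites η k := by ring
          _ ≤ _ := by gcongr
    _ = Real.log (28224 / η) + 2 * k * Real.log 4 + numBites η k * Real.log 8 := by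
        rw [Real.log_mul (by positivity) (by positivity), Real.log_mul (by positivity)
          (by positivity), Real.log_mul (by positivity) (by positivity), Real.log_pow,
          Real.log_pow]
        ring
    _ ≤ Real.log (28224 / η) + 2 * k * Real.log 4 +
        (24 / η * (4 ^ k * (Real.log (19 / η * k) / √k)) + 2) * Real.log 8 := by gcongr
    _ = 4 ^ k * (24 / η * Real.log 8 * (Real.log (19 / η * k) / √k) +
        ((Real.log (28224 / η) + 2 * Real.log 8) * ((k : ℝ) ^ 0 / 4 ^ k) +
          2 * Real.log 4 * ((k : ℝ) ^ 1 / 4 ^ k))) := by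
        field_simp
        ring
    _ ≤ 4 ^ k * Real.log 4 := by gcongr
    _ = _ := by push_cast; ring

lemma four_pow_four_pow_le_sqrt {n k : ℕ} {ε : ℝ} (hε : 0 < ε) (hε' : ε < 0.5) (hn : 1 ≤ n)
    (hk : 1 ≤ k)
    (h : (k : ℝ) ≤ Real.logb 4 (Real.logb 4 ((n : ℝ) ^ ((0.5 : ℝ) - ε)))) :
    (4 : ℝ) ^ 4 ^ k ≤ √n := by
  have hn1 : (1 : ℝ) ≤ n := by exact_mod_cast hn
  have hk1 : (1 : ℝ) ≤ k := by exact_mod_cast hk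
  have hx : (0 : ℝ) < (n : ℝ) ^ ((0.5 : ℝ) - ε) := Real.rpow_pos_of_pos (by linarith) _
  have hxn : (n : ℝ) ^ ((0.5 : ℝ) - ε) ≤ √n := by
    rw [Real.sqrt_eq_rpow]
    exact Real.rpow_le_rpow_of_exponent_le hn1 (by norm_num; linarith)
  have hx1 : 1 ≤ (n : ℝ) ^ ((0.5 : ℝ) - ε) := Real.one_le_rpow hn1 (by linarith)
  generalize (n : ℝ) ^ ((0.5 : ℝ) - ε) = x at *
  have hy0 : 0 ≤ Real.logb 4 x := Real.logb_nonneg (by norm_num) hx1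
  have hy : 0 < Real.logb 4 x := by
    refine hy0.lt_of_ne fun h0 => ?_
    rw [← h0, Real.logb_zero] at h
    linarith
  rw [Real.le_logb_iff_rpow_le (by norm_num) hy, Real.rpow_natCast,
    Real.le_logb_iff_rpow_le (by norm_num) hx] at h
  refine le_trans ?_ (h.trans hxn)
  rw [← Real.rpow_natCast]
  norm_cast

theorem exists_gammaE_le {ε η : ℝ} (hε : 0 < ε) (hε' : ε < 0.5) (hη : 0 < η) :
    ∃ N : ℕ, ∀ n : ℕ, N ≤ n → ∀ k : ℕ, 1 ≤ k →
      (k : ℝ) ≤ Real.logb 4 (Real.logb 4 ((n : ℝ) ^ ((0.5 : ℝ) - ε))) →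
      (gammaE n k (2 * k) : ℝ) ≤ (1 + η) * ((n.choose k : ℝ) / ((2 * k).choose k : ℝ)) := by
  set δ := min (η / 8) (1 / 2) with hδ
  have hδ0 : 0 < δ := by positivity
  have hδη : 8 * δ ≤ η := by have := min_le_left (η / 8) (1 / 2); linarith
  obtain ⟨K, hK⟩ := eventually_atTop.1 (eventually_threshold_le hδ0)
  set M : ℕ → ℝ := fun k =>
    28224 * (2 * k).choose k * (k * (k + 1)) * 8 ^ numBites δ k / δ with hM
  refine ⟨∑ k ∈ range K, ⌈M k ^ 2⌉₊ + 1, fun n hn k hk hkn => ?_⟩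
  have hMn : M k ≤ √n := by
    rcases le_or_gt K k with h | h
    · exact (hK k h).trans (four_pow_four_pow_le_sqrt hε hε' (by omega) hk hkn)
    · refine Real.le_sqrt_of_sq_le ((Nat.le_ceil _).trans ?_)
      have h1 := single_le_sum (f := fun k => ⌈M k ^ 2⌉₊) (fun _ _ => Nat.zero_le _)
        (mem_range.2 h)
      have h2 : ⌈M k ^ 2⌉₊ ≤ n := le_trans h1 (by omega)
      exact_mod_cast h2
  refine (gammaE_le_of_bites hk (Nat.le_add_left 1 _) hδ0 (min_le_right _ _)
    (numBites_spec hδ0 hk) hMn).trans ?_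
  gcongr

end Asymptotics

end CoverDesigns

/-- Theorem 3: fix `0 < ε < 0.5`.  (1) For all `n ≥ 1` and `1 ≤ k ≤ n/2`,
`γ(n,k,2k) ≥ C(n,k)/C(2k,k)`.  (2) For every `η > 0` there is `N` such that for all
`n ≥ N` and all `k ≥ 1` with `k ≤ log₄ log₄ (n^(0.5-ε))`,
`γ(n,k,2k) ≤ (1+η) C(n,k)/C(2k,k)`. -/
theorem stmt_14 (ε : ℝ) (hε : 0 < ε) (hε2 : ε < 0.5) :
    (∀ n k : ℕ, 1 ≤ n → 1 ≤ k → 2 * k ≤ n →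
      (n.choose k : ℝ) / ((2 * k).choose k : ℝ) ≤ (gammaE n k (2 * k) : ℝ)) ∧
    (∀ η : ℝ, 0 < η → ∃ N : ℕ, ∀ n : ℕ, N ≤ n → ∀ k : ℕ, 1 ≤ k →
      (k : ℝ) ≤ Real.logb 4 (Real.logb 4 ((n : ℝ) ^ ((0.5 : ℝ) - ε))) →
      (gammaE n k (2 * k) : ℝ) ≤ (1 + η) * ((n.choose k : ℝ) / ((2 * k).choose k : ℝ))) := by
  refine ⟨fun n k _ _ hkn => ?_, fun η hη => exists_gammaE_le hε hε2 hη⟩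
  have hr : (0 : ℝ) < (2 * k).choose k := by exact_mod_cast Nat.choose_pos (by omega)
  rw [div_le_iff₀ hr]
  exact_mod_cast choose_le_gammaE_mul_choose hkn
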